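/- Let R be a unique factorization domain and t ≥ 1. Suppose α₀,…,α_{t−1} ∈ R and β₀,…,β_{t−1} ∈ R \ {0} are such that for each i every common divisor of αᵢ and βᵢ is a unit (the fraction αᵢ/βᵢ is in lowest terms). Let q ∈ R be a least common multiple of β₀,…,β_{t−1}, and for each i let γᵢ ∈ R be the cofactor with βᵢ·γᵢ = q. Then every d ∈ R that divides q and divides αᵢ·γᵢ for all i = 0,…,t−1 is a unit; that is, the t+1 elements q, α_{t−1}·γ_{t−1}, …, α₀·γ₀ have no common non-unit divisor. -/

import Mathlib

/-- Clearing denominators of a fraction list in lowest terms by the lcm of the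
denominators yields elements with no common non-unit divisor. -/
theorem stmt_0 {R : Type*} [CommRing R] [IsDomain R] [UniqueFactorizationMonoid R]
    (t : ℕ) (ht : 1 ≤ t) (α β γ : Fin t → R) (q : R)
    (hβ : ∀ i, β i ≠ 0)
    (hlowest : ∀ i, ∀ d : R, d ∣ α i → d ∣ β i → IsUnit d)
    (hq0 : q ≠ 0)
    (hdvd : ∀ i, β i ∣ q)
    (hlcm : ∀ m : R, (∀ i, β i ∣ m) → q ∣ m)
    (hγ : ∀ i, β i * γ i = q) :
    ∀ d : R, d ∣ q → (∀ i, d ∣ α i * γ i) → IsUnit d := by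
  intro d hdq hd
  by_contra hunit
  obtain ⟨p, hp, hpd⟩ :=
    WfDvdMonoid.exists_irreducible_factor hunit (ne_zero_of_dvd_ne_zero hq0 hdq)
  have hprime : Prime p := hp.prime
  obtain ⟨m, hm⟩ := hpd.trans hdq
  have hpγ : ∀ i, p ∣ γ i := fun i => by
    rcases hprime.dvd_or_dvd (hpd.trans (hd i)) with hα | h
    · have hpq : p ∣ β i * γ i := hγ i ▸ hpd.trans hdq
      exact (hprime.dvd_or_dvd hpq).resolve_left fun h => hp.not_isUnit (hlowest i p hα h)
    · exact h
  have hqm : q ∣ m := hlcm m fun i => by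
    obtain ⟨g, hg⟩ := hpγ i
    refine ⟨g, mul_left_cancel₀ hprime.ne_zero ?_⟩
    rw [← hm, ← hγ i, hg, mul_left_comm]
  obtain ⟨c, hc⟩ := hqm
  refine hp.not_isUnit (IsUnit.of_mul_eq_one c (mul_left_cancel₀ hq0 ?_))
  rw [mul_one, mul_left_comm, ← hc, ← hm]
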